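/- For every τ ∈ ℕ₀ and every λ ∈ ℝ^R_{≥0}, the price iterates satisfy the one-step bound (1/2)(‖Λ_{τ+1} − λ‖₂² − ‖Λ_τ − λ‖₂²) ≤ ζ_τ ⟨Λ_τ − λ, A X_τ − b⟩ + (η_τ² − η_τ/2) ‖Λ_τ‖₂² + (η_τ/2) ‖λ‖₂² + ζ_τ² C₃². -/

import Mathlib

open scoped Matrix

/-- Projecting onto `[0, ∞)` does not increase the distance to a nonnegative point. -/
theorem sq_max_zero_sub_le {y l : ℝ} (hl : 0 ≤ l) : (max y 0 - l) ^ 2 ≤ (y - l) ^ 2 := by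
  rcases max_cases y 0 with ⟨h, _⟩ | ⟨h, hy⟩ <;> rw [h]
  nlinarith [mul_nonneg hl (neg_nonneg.2 hy.le)]

/-- The one-step bound for a single nonnegative coordinate. -/
theorem half_sq_projected_step_le {a l g z e : ℝ} (hl : 0 ≤ l) (he : 0 ≤ e) :
    1 / 2 * ((max ((1 - e) * a + z * g) 0 - l) ^ 2 - (a - l) ^ 2) ≤
      z * ((a - l) * g) + (e ^ 2 - e / 2) * a ^ 2 + e / 2 * l ^ 2 + z ^ 2 * g ^ 2 := by
  have hproj := sq_max_zero_sub_le (y := (1 - e) * a + z * g) hl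
  nlinarith [sq_nonneg (z * g + e * a), mul_nonneg he (sq_nonneg (a - l))]

/-- **One-step bound for the price iterates.**
With Λ_{τ+1} = [(1 − η_τ)Λ_τ + ζ_τ(A X_τ − b)]₊ and ‖Ax − b‖₂ ≤ C₃ on 𝒳,
for every τ and every λ ≥ 0:
(1/2)(‖Λ_{τ+1} − λ‖₂² − ‖Λ_τ − λ‖₂²) ≤ ζ_τ⟨Λ_τ − λ, AX_τ − b⟩
  + (η_τ² − η_τ/2)‖Λ_τ‖₂² + (η_τ/2)‖λ‖₂² + ζ_τ²C₃².
(Here ‖v‖₂² = ⟨v,v⟩.) -/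
theorem stmt6 {R D : ℕ} (A : Matrix (Fin R) (Fin D) ℝ) (b : Fin R → ℝ)
    (𝒳 : Set (Fin D → ℝ)) (C₃ : ℝ) (hC₃0 : 0 ≤ C₃)
    (hC₃ : ∀ x ∈ 𝒳, Real.sqrt ((A.mulVec x - b) ⬝ᵥ (A.mulVec x - b)) ≤ C₃)
    (X : ℕ → Fin D → ℝ) (hX : ∀ τ, X τ ∈ 𝒳)
    (Λ : ℕ → Fin R → ℝ) (hΛ0 : ∀ r, 0 ≤ Λ 0 r)
    (ζ η : ℕ → ℝ) (hζ : ∀ τ, ζ τ ∈ Set.Ioo (0 : ℝ) 1) (hη : ∀ τ, 0 ≤ η τ)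
    (hΛ : ∀ τ r, Λ (τ + 1) r = max ((1 - η τ) * Λ τ r + ζ τ * (A.mulVec (X τ) - b) r) 0) :
    ∀ (τ : ℕ) (lam : Fin R → ℝ), (∀ r, 0 ≤ lam r) →
      1 / 2 * ((Λ (τ + 1) - lam) ⬝ᵥ (Λ (τ + 1) - lam) - (Λ τ - lam) ⬝ᵥ (Λ τ - lam)) ≤
        ζ τ * ((Λ τ - lam) ⬝ᵥ (A.mulVec (X τ) - b))
        + (η τ ^ 2 - η τ / 2) * (Λ τ ⬝ᵥ Λ τ) + η τ / 2 * (lam ⬝ᵥ lam)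
        + ζ τ ^ 2 * C₃ ^ 2 := by
  intro τ lam hlam
  set g := A.mulVec (X τ) - b with hg
  have hgC : g ⬝ᵥ g ≤ C₃ ^ 2 := (Real.sqrt_le_left hC₃0).1 (hC₃ _ (hX τ))
  have hsum : 1 / 2 * ((Λ (τ + 1) - lam) ⬝ᵥ (Λ (τ + 1) - lam) - (Λ τ - lam) ⬝ᵥ (Λ τ - lam)) ≤
      ζ τ * ((Λ τ - lam) ⬝ᵥ g) + (η τ ^ 2 - η τ / 2) * (Λ τ ⬝ᵥ Λ τ)
        + η τ / 2 * (lam ⬝ᵥ lam) + ζ τ ^ 2 * (g ⬝ᵥ g) := by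
    simp only [dotProduct, Finset.mul_sum, ← Finset.sum_sub_distrib, ← Finset.sum_add_distrib]
    refine Finset.sum_le_sum fun r _ => ?_
    simp only [Pi.sub_apply (Λ _) lam, hΛ τ r, ← hg, ← pow_two]
    exact half_sq_projected_step_le (hlam r) (hη τ)
  have hbound := mul_le_mul_of_nonneg_left hgC (sq_nonneg (ζ τ))
  linarith
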